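/- For every natural number n ≥ 1 there exists a rooted tree S′ with one distinguished (marked) leaf vertex w that is NCA-universal for the family of all rooted trees on at most n vertices with one marked leaf, and such that |V(S′)| ≤ c·n^{2.318} for an absolute constant c: for every rooted tree T with at most n vertices and one marked leaf there is an injective map φ : V(T) → V(S′) mapping the marked leaf of T to w and satisfying φ(nca_T(u,v)) = nca_{S′}(φ(u), φ(v)) for all vertices u, v of T. -/

import Mathlib

/-- `u` is an ancestor of `v` w.r.t. the parent function `p`
(every vertex is an ancestor of itself, via `k = 0`). -/
def IsAncestorOf {V : Type*} (p : V → V) (u v : V) : Prop := ∃ k : ℕ, p^[k] v = u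

/-- `w` is the nearest common ancestor of `u` and `v` w.r.t. the parent function `p`:
`w` is a common ancestor and every common ancestor of `u` and `v` is an ancestor of `w`
(i.e. `w` is the common ancestor furthest from the root). -/
def IsNcaOf {V : Type*} (p : V → V) (u v w : V) : Prop :=
  IsAncestorOf p w u ∧ IsAncestorOf p w v ∧
    ∀ x, IsAncestorOf p x u → IsAncestorOf p x v → IsAncestorOf p x w

/-- A finite rooted tree, encoded by a parent function on `Fin n`:
the root is its own parent and every vertex reaches the root by iterating `parent`. -/
structure FinRootedTree where
  n : ℕ
  pos : 0 < n
  parent : Fin n → Fin n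
  root : Fin n
  parent_root : parent root = root
  reaches_root : ∀ v, ∃ k : ℕ, parent^[k] v = root

namespace FinRootedTree

def IsAncestor (T : FinRootedTree) (u v : Fin T.n) : Prop := IsAncestorOf T.parent u v

def IsNCA (T : FinRootedTree) (u v w : Fin T.n) : Prop := IsNcaOf T.parent u v w

end FinRootedTree

/-- An NCA-preserving embedding of `T` into `S`: an injective map on the vertices
that commutes with the nearest-common-ancestor function. -/
def NcaEmbedding (T S : FinRootedTree) (φ : Fin T.n → Fin S.n) : Prop :=
  Function.Injective φ ∧ ∀ u v w, T.IsNCA u v w → S.IsNCA (φ u) (φ v) (φ w)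

namespace FinRootedTree

/-- A rooted tree is binary if every vertex has at most two children. -/
def IsBinary (T : FinRootedTree) : Prop :=
  ∀ v : Fin T.n, {u : Fin T.n | T.parent u = v ∧ u ≠ v}.ncard ≤ 2

/-- A leaf is a vertex with no children. -/
def IsLeaf (T : FinRootedTree) (w : Fin T.n) : Prop := ∀ u, T.parent u = w → u = w

end FinRootedTree

namespace NcaUniversal

/-- Finite ordered trees whose vertices carry a Boolean label (`true` means marked). -/
inductive LTree : Type
  | node : Bool → List LTree → LTree

namespace LTree

theorem children_induction {P : LTree → Prop}
    (h : ∀ b l, (∀ t ∈ l, P t) → P (node b l)) : ∀ t, P t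
  | node b l => h b l fun t _ => children_induction h t

/-- The number of vertices. -/
def size : LTree → ℕ
  | node _ l => 1 + (l.map size).sum

theorem size_node (b : Bool) (l : List LTree) : (node b l).size = 1 + (l.map size).sum := by
  rw [size]

/-- The label at the vertex reached from the root by following the given child indices. -/
def label : LTree → List ℕ → Option Bool
  | node b _, [] => some b
  | node _ l, i :: p => l[i]?.bind fun t => label t p

@[simp] theorem label_nil (b : Bool) (l : List LTree) : (node b l).label [] = some b := by
  rw [label]

@[simp] theorem label_cons (b : Bool) (l : List LTree) (i : ℕ) (p : List ℕ) :
    (node b l).label (i :: p) = l[i]?.bind fun t => t.label p := by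
  rw [label]

theorem label_ne_none_of_append {q : List ℕ} :
    ∀ {t : LTree} {p : List ℕ}, t.label (p ++ q) ≠ none → t.label p ≠ none
  | node _ _, [], _ => by simp
  | node _ l, i :: p, h => by
    rw [List.cons_append, label_cons] at h
    rw [label_cons]
    cases hi : l[i]? with
    | none => simp [hi] at h
    | some t =>
      simp only [hi, Option.bind_some] at h ⊢
      exact label_ne_none_of_append h

end LTree

/-- The longest common prefix. -/
def lcp : List ℕ → List ℕ → List ℕ
  | i :: p, j :: q => if i = j then i :: lcp p q else []
  | _, _ => []

@[simp] theorem lcp_nil_left (p : List ℕ) : lcp [] p = [] := by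
  simp [lcp]

@[simp] theorem lcp_nil_right (p : List ℕ) : lcp p [] = [] := by
  cases p <;> simp [lcp]

theorem lcp_cons_cons (i j : ℕ) (p q : List ℕ) :
    lcp (i :: p) (j :: q) = if i = j then i :: lcp p q else [] := by
  rw [lcp]

theorem lcp_prefix_left : ∀ p q : List ℕ, lcp p q <+: p
  | [], _ => by simp
  | _ :: _, [] => by simp
  | i :: p, j :: q => by
    rw [lcp_cons_cons]
    split_ifs with h
    · simpa using lcp_prefix_left p q
    · simp

theorem lcp_prefix_right : ∀ p q : List ℕ, lcp p q <+: q
  | [], _ => by simp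
  | _ :: _, [] => by simp
  | i :: p, j :: q => by
    rw [lcp_cons_cons]
    split_ifs with h
    · simpa [h] using lcp_prefix_right p q
    · simp

theorem prefix_lcp : ∀ {r p q : List ℕ}, r <+: p → r <+: q → r <+: lcp p q
  | [], _, _, _, _ => by simp
  | k :: r, [], _, h, _ => by simp at h
  | k :: r, _ :: _, [], _, h => by simp at h
  | k :: r, i :: p, j :: q, hp, hq => by
    rw [List.cons_prefix_cons] at hp hq
    obtain ⟨rfl, hp⟩ := hp
    obtain ⟨rfl, hq⟩ := hq
    simpa [lcp_cons_cons] using prefix_lcp hp hq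

namespace LTree

/-- `f` maps vertices of `t` (given by their addresses) injectively to vertices of `s`,
preserving labels and nearest common ancestors. -/
structure IsEmb (f : List ℕ → List ℕ) (t s : LTree) : Prop where
  label_eq : ∀ p, t.label p ≠ none → s.label (f p) = t.label p
  map_lcp : ∀ p q, t.label p ≠ none → t.label q ≠ none → lcp (f p) (f q) = f (lcp p q)
  inj : ∀ p q, t.label p ≠ none → t.label q ≠ none → f p = f q → p = q

def Emb (t s : LTree) : Prop := ∃ f, IsEmb f t s

theorem Emb.refl (t : LTree) : Emb t t := ⟨id, by simp, by simp, by simp⟩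

theorem Emb.trans {t s r : LTree} (h₁ : Emb t s) (h₂ : Emb s r) : Emb t r := by
  obtain ⟨f, hf⟩ := h₁
  obtain ⟨g, hg⟩ := h₂
  have key : ∀ p, t.label p ≠ none → s.label (f p) ≠ none := fun p hp => by
    rwa [hf.label_eq p hp]
  refine ⟨g ∘ f, fun p hp => ?_, fun p q hp hq => ?_, fun p q hp hq h => ?_⟩
  · exact (hg.label_eq _ (key p hp)).trans (hf.label_eq p hp)
  · exact (hg.map_lcp _ _ (key p hp) (key q hq)).trans (congrArg g (hf.map_lcp p q hp hq))
  · exact hf.inj p q hp hq (hg.inj _ _ (key p hp) (key q hq) h)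

theorem Emb.of_child {t s : LTree} {b : Bool} {l : List LTree} (hs : s ∈ l) (h : Emb t s) :
    Emb t (node b l) := by
  obtain ⟨f, hf⟩ := h
  obtain ⟨i, hi⟩ := List.mem_iff_getElem?.1 hs
  refine ⟨fun p => i :: f p, fun p hp => ?_, fun p q hp hq => ?_, fun p q hp hq h => ?_⟩
  · simpa [hi] using hf.label_eq p hp
  · simpa [lcp_cons_cons] using hf.map_lcp p q hp hq
  · exact hf.inj p q hp hq (List.cons.inj h).2

/-- The trees of `F` embed into pairwise different trees of `G`. -/
def ForestEmb (F G : List LTree) : Prop :=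
  ∃ σ : ℕ → ℕ, (∀ i j, i < F.length → j < F.length → σ i = σ j → i = j) ∧
    ∀ i t, F[i]? = some t → ∃ s, G[σ i]? = some s ∧ Emb t s

namespace ForestEmb

theorem nil (G : List LTree) : ForestEmb [] G := ⟨id, by simp, by simp⟩

theorem refl (F : List LTree) : ForestEmb F F :=
  ⟨id, by simp, fun _ t h => ⟨t, h, Emb.refl t⟩⟩

theorem trans {F G H : List LTree} (h₁ : ForestEmb F G) (h₂ : ForestEmb G H) :
    ForestEmb F H := by
  obtain ⟨σ, hσ, hF⟩ := h₁
  obtain ⟨τ, hτ, hG⟩ := h₂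
  have key : ∀ i, i < F.length → σ i < G.length := fun i hi => by
    obtain ⟨s, hs, -⟩ := hF i _ (List.getElem?_eq_getElem hi)
    exact (List.getElem?_eq_some_iff.1 hs).1
  refine ⟨τ ∘ σ, fun i j hi hj h => hσ i j hi hj (hτ _ _ (key i hi) (key j hj) h), ?_⟩
  intro i t ht
  obtain ⟨s, hs, hts⟩ := hF i t ht
  obtain ⟨r, hr, hsr⟩ := hG _ s hs
  exact ⟨r, hr, hts.trans hsr⟩

theorem cons {F G : List LTree} {t s : LTree} (h : Emb t s) (hFG : ForestEmb F G) :
    ForestEmb (t :: F) (s :: G) := by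
  obtain ⟨σ, hσ, hF⟩ := hFG
  refine ⟨fun i => i.casesOn 0 fun k => σ k + 1, ?_, ?_⟩
  · rintro (_ | i) (_ | j) hi hj hij
    · rfl
    · simp at hij
    · simp at hij
    · simp only [List.length_cons, Nat.add_lt_add_iff_right] at hi hj
      exact congrArg _ (hσ i j hi hj (by simpa using hij))
  · rintro (_ | i) r hr
    · obtain rfl : t = r := by simpa using hr
      exact ⟨s, by simp, h⟩
    · simpa using hF i r (by simpa using hr)

theorem cons_concat {F G : List LTree} {t s : LTree} (h : Emb t s) (hFG : ForestEmb F G) :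
    ForestEmb (t :: F) (G ++ [s]) := by
  obtain ⟨σ, hσ, hF⟩ := hFG
  have key : ∀ i, i < F.length → σ i < G.length := fun i hi => by
    obtain ⟨s, hs, -⟩ := hF i _ (List.getElem?_eq_getElem hi)
    exact (List.getElem?_eq_some_iff.1 hs).1
  refine ⟨fun i => i.casesOn G.length fun k => σ k, ?_, ?_⟩
  · rintro (_ | i) (_ | j) hi hj hij <;>
      simp only [List.length_cons, Nat.add_lt_add_iff_right] at hi hj hij
    · rfl
    · exact absurd hij (key j hj).ne'
    · exact absurd hij (key i hi).ne
    · exact congrArg _ (hσ i j hi hj hij)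
  · rintro (_ | i) r hr
    · obtain rfl : t = r := by simpa using hr
      exact ⟨s, by simp, h⟩
    · obtain ⟨u, hu, hru⟩ := hF i r (by simpa using hr)
      exact ⟨u, by simpa [List.getElem?_append_left (List.getElem?_eq_some_iff.1 hu).1] using hu,
        hru⟩

theorem append_right {F G : List LTree} (H : List LTree) (hFG : ForestEmb F G) :
    ForestEmb F (G ++ H) := by
  obtain ⟨σ, hσ, hF⟩ := hFG
  refine ⟨σ, hσ, fun i t ht => ?_⟩
  obtain ⟨s, hs, hts⟩ := hF i t ht
  exact ⟨s, by rwa [List.getElem?_append_left (List.getElem?_eq_some_iff.1 hs).1], hts⟩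

theorem of_perm {F G : List LTree} (h : F.Perm G) : ForestEmb F G := by
  induction h with
  | nil => exact nil _
  | cons t _ ih => exact cons (Emb.refl t) ih
  | swap t s F =>
    refine ⟨fun i => if i = 0 then 1 else if i = 1 then 0 else i, fun i j _ _ h => ?_, ?_⟩
    · dsimp only at h
      split_ifs at h <;> omega
    · rintro (_ | _ | i) r hr
      · exact ⟨r, by simpa using hr, Emb.refl r⟩
      · exact ⟨r, by simpa using hr, Emb.refl r⟩
      · exact ⟨r, by simpa using hr, Emb.refl r⟩
  | trans _ _ ih₁ ih₂ => exact ih₁.trans ih₂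

end ForestEmb

theorem Emb.node {F G : List LTree} (b : Bool) (h : ForestEmb F G) :
    Emb (node b F) (node b G) := by
  obtain ⟨σ, hσ, hF⟩ := h
  have hg : ∀ i, ∃ g, ∀ t, F[i]? = some t → ∃ s, G[σ i]? = some s ∧ IsEmb g t s := by
    intro i
    cases hi : F[i]? with
    | none => exact ⟨id, by simp⟩
    | some t =>
      obtain ⟨s, hs, g, hg⟩ := hF i t hi
      refine ⟨g, fun r hr => ?_⟩
      obtain rfl : t = r := by simpa using hr
      exact ⟨s, hs, hg⟩
  choose g hg using hg
  have key : ∀ i p, (LTree.node b F).label (i :: p) ≠ none → i < F.length ∧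
      ∃ t, F[i]? = some t ∧ t.label p ≠ none := by
    intro i p h
    cases hi : F[i]? with
    | none => simp [hi] at h
    | some t => exact ⟨(List.getElem?_eq_some_iff.1 hi).1, t, rfl, by simpa [hi] using h⟩
  refine ⟨fun p => p.casesOn [] fun i p => σ i :: g i p, ?_, ?_, ?_⟩
  · rintro (_ | ⟨i, p⟩) hp
    · simp
    · obtain ⟨-, t, ht, hp⟩ := key i p hp
      obtain ⟨s, hs, hts⟩ := hg i t ht
      simpa [ht, hs] using hts.label_eq p hp
  · rintro (_ | ⟨i, p⟩) (_ | ⟨j, q⟩) hp hq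
    · simp
    · simp
    · simp
    · obtain ⟨hi, t, ht, hp⟩ := key i p hp
      obtain ⟨hj, r, hr, hq⟩ := key j q hq
      by_cases hij : i = j
      · subst hij
        obtain rfl : t = r := by simpa [ht] using hr
        obtain ⟨s, hs, hts⟩ := hg i t ht
        simpa [lcp_cons_cons] using hts.map_lcp p q hp hq
      · have : σ i ≠ σ j := fun h => hij (hσ i j hi hj h)
        simp [lcp_cons_cons, hij, this]
  · rintro (_ | ⟨i, p⟩) (_ | ⟨j, q⟩) hp hq h
    · rfl
    · simp at h
    · simp at h
    · obtain ⟨hi, t, ht, hp⟩ := key i p hp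
      obtain ⟨hj, r, hr, hq⟩ := key j q hq
      obtain ⟨h₁, h₂⟩ := List.cons.inj h
      obtain rfl := hσ i j hi hj h₁
      obtain rfl : t = r := by simpa [ht] using hr
      obtain ⟨s, hs, hts⟩ := hg i t ht
      rw [hts.inj p q hp hq h₂]

/-- No vertex is marked. -/
def Unmarked (t : LTree) : Prop := ∀ p, t.label p ≠ some true

theorem unmarked_node {b : Bool} {l : List LTree} :
    (LTree.node b l).Unmarked ↔ b = false ∧ ∀ t ∈ l, t.Unmarked := by
  constructor
  · intro h
    refine ⟨by simpa using h [], fun t ht p hp => ?_⟩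
    obtain ⟨i, hi⟩ := List.mem_iff_getElem?.1 ht
    exact h (i :: p) (by simp [hi, hp])
  · rintro ⟨rfl, h⟩ (_ | ⟨i, p⟩) hp
    · simp at hp
    · obtain ⟨t, ht, hp⟩ := Option.bind_eq_some_iff.1 ((label_cons ..).symm.trans hp)
      exact h t (List.mem_iff_getElem?.2 ⟨i, ht⟩) p hp

/-- A context is a path whose vertices carry forests of further subtrees;
`plug C t` hangs `t` below the last vertex of the path. -/
def plug : List (List LTree) → LTree → LTree
  | [], t => t
  | F :: C, t => .node false (plug C t :: F)

theorem plug_append (C D : List (List LTree)) (t : LTree) :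
    plug (C ++ D) t = plug C (plug D t) := by
  induction C with
  | nil => rfl
  | cons F C ih => simp [plug, ih]

def forestSize (F : List LTree) : ℕ := (F.map size).sum

@[simp] theorem forestSize_nil : forestSize [] = 0 := rfl

@[simp] theorem forestSize_cons (t : LTree) (F : List LTree) :
    forestSize (t :: F) = t.size + forestSize F := by
  simp [forestSize]

@[simp] theorem forestSize_append (F G : List LTree) :
    forestSize (F ++ G) = forestSize F + forestSize G := by
  simp [forestSize]

@[simp] theorem size_node_eq (b : Bool) (l : List LTree) :
    (LTree.node b l).size = 1 + forestSize l :=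
  size_node b l

theorem size_pos : ∀ t : LTree, 0 < t.size
  | .node _ _ => by simp

def contextSize (C : List (List LTree)) : ℕ := (C.map fun F => 1 + forestSize F).sum

@[simp] theorem contextSize_nil : contextSize [] = 0 := rfl

@[simp] theorem contextSize_cons (F : List LTree) (C : List (List LTree)) :
    contextSize (F :: C) = 1 + forestSize F + contextSize C := by
  simp [contextSize]

@[simp] theorem contextSize_append (C D : List (List LTree)) :
    contextSize (C ++ D) = contextSize C + contextSize D := by
  simp [contextSize]

theorem size_plug (C : List (List LTree)) (t : LTree) :
    (plug C t).size = contextSize C + t.size := by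
  induction C with
  | nil => simp [plug]
  | cons F C ih => simp [plug, ih]; omega

def UnmarkedForest (F : List LTree) : Prop := ∀ t ∈ F, t.Unmarked

def UnmarkedContext (C : List (List LTree)) : Prop := ∀ F ∈ C, UnmarkedForest F

theorem UnmarkedContext.plug {C : List (List LTree)} (hC : UnmarkedContext C) {t : LTree}
    (ht : t.Unmarked) : (plug C t).Unmarked := by
  induction C with
  | nil => exact ht
  | cons F C ih =>
    refine unmarked_node.2 ⟨rfl, List.forall_mem_cons.2 ⟨ih fun G hG => ?_, ?_⟩⟩
    · exact hC G (List.mem_cons_of_mem _ hG)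
    · exact hC F List.mem_cons_self

theorem Emb.plug_right {t s : LTree} (h : Emb t s) (D : List (List LTree)) :
    Emb t (plug D s) := by
  induction D with
  | nil => exact h
  | cons F D ih => exact ih.of_child List.mem_cons_self

def UniversalTree (n : ℕ) (U : LTree) : Prop :=
  ∀ t : LTree, t.Unmarked → t.size ≤ n → Emb t U

def UniversalContext (n : ℕ) (D : List (List LTree)) : Prop :=
  ∀ C, UnmarkedContext C → contextSize C ≤ n → ∀ t s, Emb t s → Emb (plug C t) (plug D s)

/-- Cutting an unmarked tree at a deepest vertex with more than `b` descendants. -/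
theorem exists_heavy_decomposition (b : ℕ) : ∀ t : LTree, t.Unmarked →
    ∃ C F, UnmarkedContext C ∧ UnmarkedForest F ∧
      contextSize C + (LTree.node false F).size = t.size ∧ (∀ x ∈ F, x.size ≤ b) ∧
      (C = [] ∨ b < (LTree.node false F).size) ∧ Emb t (plug C (.node false F)) := by
  apply children_induction
  intro c l ih ht
  obtain ⟨rfl, hl⟩ := unmarked_node.1 ht
  by_cases hb : ∀ x ∈ l, x.size ≤ b
  · exact ⟨[], l, by simp [UnmarkedContext], hl, by simp, hb, Or.inl rfl, Emb.refl _⟩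
  · push Not at hb
    obtain ⟨x, hx, hbx⟩ := hb
    obtain ⟨C, F, hC, hF, hsize, hFb, hor, hemb⟩ := ih x hx (hl x hx)
    obtain ⟨l₁, l₂, rfl⟩ := List.append_of_mem hx
    refine ⟨(l₁ ++ l₂) :: C, F, ?_, hF, ?_, hFb, Or.inr ?_, ?_⟩
    · refine List.forall_mem_cons.2 ⟨fun t ht => hl t ?_, hC⟩
      simp only [List.mem_append, List.mem_cons] at ht ⊢
      tauto
    · simp only [size_node_eq, contextSize_cons, forestSize_append, forestSize_cons] at hsize ⊢
      omega
    · rcases hor with rfl | h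
      · simp only [contextSize_nil, zero_add] at hsize
        rwa [hsize]
      · exact h
    · exact Emb.node _ ((ForestEmb.of_perm List.perm_middle).trans
        (ForestEmb.cons hemb (ForestEmb.refl _)))

theorem exists_split_context (h : ℕ) : ∀ C : List (List LTree), h < contextSize C →
    ∃ C₁ F C₂, C = C₁ ++ F :: C₂ ∧ contextSize C₁ ≤ h ∧
      h < contextSize C₁ + 1 + forestSize F := by
  intro C
  induction C generalizing h with
  | nil => simp
  | cons F C ih =>
    intro hC
    by_cases hF : h < 1 + forestSize F
    · exact ⟨[], F, C, by simp, by simp, by simpa using hF⟩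
    · rw [contextSize_cons] at hC
      obtain ⟨C₁, G, C₂, rfl, h₁, h₂⟩ := ih (h - (1 + forestSize F)) (by omega)
      exact ⟨F :: C₁, G, C₂, by simp, by simp; omega, by simp; omega⟩

/-- The `i`-th largest tree (counting from `0`) of a forest on at most `m` vertices has at most
`m / (i + 1)` vertices. -/
theorem forestEmb_range {m : ℕ} {g : ℕ → LTree} (F : List LTree) (hm : forestSize F ≤ m)
    (hg : ∀ i, i < m → ∀ x ∈ F, x.size ≤ m / (i + 1) → Emb x (g i)) :
    ForestEmb F ((List.range m).map g) := by
  have key : ∀ k, ∀ F : List LTree, F.length = k → forestSize F ≤ m →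
      (∀ i, i < m → ∀ x ∈ F, x.size ≤ m / (i + 1) → Emb x (g i)) →
      ForestEmb F ((List.range k).map g) := by
    intro k
    induction k with
    | zero =>
      intro F hF _ _
      rw [List.length_eq_zero_iff.1 hF]
      exact ForestEmb.nil _
    | succ k ih =>
      intro F hF hm hg
      have hne : F ≠ [] := by rintro rfl; simp at hF
      obtain ⟨x, hx, hmin⟩ : ∃ x ∈ F, ∀ y ∈ F, x.size ≤ y.size := by
        have := List.toFinset_nonempty_iff (List.map size F)|>.2 (by simpa using hne)
        obtain ⟨a, ha, hmin⟩ := Finset.exists_min_image _ id this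
        simp only [List.mem_toFinset, List.mem_map, id] at ha hmin
        obtain ⟨x, hx, rfl⟩ := ha
        exact ⟨x, hx, fun y hy => hmin _ ⟨y, hy, rfl⟩⟩
      have hxm : x.size * (k + 1) ≤ m := by
        refine le_trans ?_ hm
        have := List.card_nsmul_le_sum (F.map size) x.size (by simpa using hmin)
        simpa [hF, mul_comm, forestSize] using this
      obtain ⟨l₁, l₂, rfl⟩ := List.append_of_mem hx
      rw [List.range_succ, List.map_append]
      refine (ForestEmb.of_perm List.perm_middle).trans (ForestEmb.cons_concat ?_ (ih _ ?_ ?_ ?_))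
      · refine hg k ?_ x hx ((Nat.le_div_iff_mul_le (by omega)).2 hxm)
        have := size_pos x
        nlinarith
      · simp only [List.length_append, List.length_cons] at hF ⊢
        omega
      · simp only [forestSize_append, forestSize_cons] at hm ⊢
        omega
      · intro i hi y hy
        refine hg i hi y ?_
        simp only [List.mem_append, List.mem_cons] at hy ⊢
        tauto
  have hlen : F.length ≤ m := by
    refine le_trans ?_ hm
    have := List.card_nsmul_le_sum (F.map size) 1
      (by simpa [Nat.succ_le_iff] using fun a _ => size_pos a)
    simpa [forestSize] using this
  obtain ⟨d, rfl⟩ := Nat.exists_eq_add_of_le hlen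
  rw [List.range_add, List.map_append]
  exact (key _ F rfl hm hg).append_right _

theorem rpow_div_le {x r : ℝ} (hx : 0 < x) (hr : 0 ≤ r) (k : ℤ) (h : x ^ k ≤ r ^ 500) :
    x ^ ((k : ℝ) / 500) ≤ r := by
  refine le_of_pow_le_pow_left₀ (n := 500) (by norm_num) hr ?_
  rw [← Real.rpow_natCast, ← Real.rpow_mul hx.le]
  have : (k : ℝ) / 500 * ((500 : ℕ) : ℝ) = k := by push_cast; ring
  rwa [this, Real.rpow_intCast]

theorem one_div_rpow_le_telescope {s x : ℝ} (hs : 1 ≤ s) (hx : 0 < x) :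
    s * (x + 1) ^ (-(s + 1)) ≤ x ^ (-s) - (x + 1) ^ (-s) := by
  have hx1 : 0 < x + 1 := by linarith
  have h := one_add_mul_self_le_rpow_one_add (s := 1 / x) (by
    have : 0 < 1 / x := by positivity
    linarith) hs
  have h₁ : (1 + 1 / x) ^ s = x ^ (-s) * (x + 1) ^ s := by
    rw [show 1 + 1 / x = x⁻¹ * (x + 1) by field_simp, Real.mul_rpow (by positivity) hx1.le,
      Real.inv_rpow hx.le, Real.rpow_neg hx.le]
  have h₂ : (x + 1) ^ (-s) * (x + 1) ^ s = 1 := by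
    rw [← Real.rpow_add hx1]; simp
  have h₃ : (x + 1) ^ (-(s + 1)) = (x + 1) ^ (-s) / (x + 1) := by
    rw [neg_add, Real.rpow_add hx1, Real.rpow_neg_one]; rfl
  have hp : 0 < (x + 1) ^ (-s) := Real.rpow_pos_of_pos hx1 _
  have h₄ : x ^ (-s) ≥ (x + 1) ^ (-s) * (1 + s * (1 / x)) := by
    calc (x + 1) ^ (-s) * (1 + s * (1 / x)) ≤ (x + 1) ^ (-s) * (x ^ (-s) * (x + 1) ^ s) := by
          rw [← h₁]; gcongr
      _ = x ^ (-s) := by rw [mul_left_comm, h₂, mul_one]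
  have h₅ : s / (x + 1) ≤ s * (1 / x) := by
    rw [mul_one_div]
    exact div_le_div_of_nonneg_left (by linarith) hx (by linarith)
  rw [h₃]
  calc s * ((x + 1) ^ (-s) / (x + 1)) = (x + 1) ^ (-s) * (s / (x + 1)) := by ring
    _ ≤ (x + 1) ^ (-s) * (s * (1 / x)) := by gcongr
    _ ≤ _ := by linarith

theorem sum_rpow_le_thirty :
    ∑ i ∈ Finset.range 30, ((i : ℝ) + 1) ^ (-2.318 : ℝ) ≤ 1.414591 := by
  let L : List ℕ := [10000000, 2005453, 783490, 402185, 239766, 157126, 109917, 80657, 61386,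
    48084, 38553, 31511, 26175, 22044, 18786, 16176, 14055, 12311, 10861, 9644, 8612, 7732, 6975,
    6320, 5749, 5250, 4810, 4421, 4076, 3768]
  have hL : ∀ i < 30, 10 ^ 3500 ≤ L.getD i 0 ^ 500 * (i + 1) ^ 1159 := by decide +kernel
  have hsum : ∑ i ∈ Finset.range 30, L.getD i 0 ≤ 14145910 := by decide +kernel
  calc ∑ i ∈ Finset.range 30, ((i : ℝ) + 1) ^ (-2.318 : ℝ)
      ≤ ∑ i ∈ Finset.range 30, (L.getD i 0 : ℝ) / 10 ^ 7 := by
        refine Finset.sum_le_sum fun i hi => ?_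
        have hi : (10 : ℝ) ^ 3500 ≤ (L.getD i 0 : ℝ) ^ 500 * ((i : ℝ) + 1) ^ 1159 := by
          exact_mod_cast hL i (Finset.mem_range.1 hi)
        have hpos : (0 : ℝ) < (i : ℝ) + 1 := by positivity
        rw [show (-2.318 : ℝ) = ((-1159 : ℤ) : ℝ) / 500 by norm_num]
        refine rpow_div_le hpos (by positivity) _ ?_
        rw [zpow_neg, div_pow, ← pow_mul, inv_eq_one_div,
          div_le_div_iff₀ (by positivity) (by positivity), one_mul]
        exact hi
    _ = ((∑ i ∈ Finset.range 30, L.getD i 0 : ℕ) : ℝ) / 10 ^ 7 := by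
        rw [← Finset.sum_div, Nat.cast_sum]
    _ ≤ ((14145910 : ℕ) : ℝ) / 10 ^ 7 := by gcongr
    _ ≤ 1.414591 := by norm_num

set_option exponentiation.threshold 2000 in
theorem sum_rpow_le (m : ℕ) :
    ∑ i ∈ Finset.range m, ((i : ℝ) + 1) ^ (-2.318 : ℝ) ≤ 1.42317 := by
  have key : ∀ k : ℕ, ∑ i ∈ Finset.range (30 + k), ((i : ℝ) + 1) ^ (-2.318 : ℝ) ≤
      1.414591 + ((30 : ℝ) ^ (-1.318 : ℝ) - (30 + (k : ℝ)) ^ (-1.318 : ℝ)) / 1.318 := by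
    intro k
    induction k with
    | zero => simpa using sum_rpow_le_thirty
    | succ k ih =>
      rw [← add_assoc, Finset.sum_range_succ]
      have h := one_div_rpow_le_telescope (s := 1.318) (x := 30 + (k : ℝ)) (by norm_num)
        (by positivity)
      rw [show (-(1.318 + 1) : ℝ) = -2.318 by norm_num, mul_comm,
        ← le_div_iff₀ (by norm_num)] at h
      push_cast
      rw [← add_assoc]
      refine (add_le_add ih h).trans (le_of_eq ?_)
      ring
  have h30 : (30 : ℝ) ^ (-1.318 : ℝ) ≤ 0.011303 := by
    rw [show (-1.318 : ℝ) = ((-659 : ℤ) : ℝ) / 500 by norm_num]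
    exact rpow_div_le (by norm_num) (by norm_num) _ (by norm_num)
  have hp : (0 : ℝ) < (30 + (m : ℝ)) ^ (-1.318 : ℝ) := Real.rpow_pos_of_pos (by positivity) _
  calc ∑ i ∈ Finset.range m, ((i : ℝ) + 1) ^ (-2.318 : ℝ)
      ≤ ∑ i ∈ Finset.range (30 + m), ((i : ℝ) + 1) ^ (-2.318 : ℝ) :=
        Finset.sum_le_sum_of_subset_of_nonneg (by simp) fun i _ _ =>
          Real.rpow_nonneg (by positivity) _
    _ ≤ _ := key m
    _ ≤ 1.414591 + 0.011303 / 1.318 := by gcongr; linarith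
    _ ≤ 1.42317 := by norm_num

theorem universalTree_plug {n b : ℕ} (hb : b < n) {M : List (List LTree)} {g : ℕ → LTree}
    (hM : UniversalContext (n - 1 - b) M)
    (hg : ∀ i, i < n - 1 → UniversalTree (if i = 0 then b else (n - 1) / (i + 1)) (g i)) :
    UniversalTree n (plug M (.node false ((List.range (n - 1)).map g))) := by
  intro t ht htn
  obtain ⟨C, F, hC, hF, hsize, hFb, hor, hemb⟩ := exists_heavy_decomposition b t ht
  rw [size_node_eq] at hsize hor
  refine hemb.trans (hM C hC ?_ _ _ (Emb.node _ (forestEmb_range F ?_ fun i hi x hx hxi => ?_)))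
  · rcases hor with rfl | h
    · simp
    · omega
  · omega
  · refine hg i hi x (hF x hx) ?_
    split_ifs
    · exact hFb x hx
    · exact hxi

theorem universalContext_append {n : ℕ} {M : List (List LTree)} {g : ℕ → LTree}
    (hM : UniversalContext (n / 2) M)
    (hg : ∀ i, i < n - 1 → UniversalTree ((n - 1) / (i + 1)) (g i)) :
    UniversalContext n (M ++ (List.range (n - 1)).map g :: M) := by
  intro C hC hCn t s hts
  rw [plug_append]
  by_cases h : contextSize C ≤ n / 2
  · exact hM C hC h t _ (hts.plug_right (_ :: M))
  · obtain ⟨C₁, F, C₂, rfl, h₁, h₂⟩ := exists_split_context (n / 2) C (not_le.1 h)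
    rw [contextSize_append, contextSize_cons] at hCn
    have hF : UnmarkedForest F := hC F (by simp)
    rw [plug_append]
    refine hM C₁ (fun G hG => hC G (by simp [hG])) h₁ _ _ (Emb.node _ (ForestEmb.cons ?_ ?_))
    · exact hM C₂ (fun G hG => hC G (by simp [hG])) (by omega) _ _ hts
    · exact forestEmb_range F (by omega) fun i hi x hx hxi => hg i hi x (hF x hx) hxi

theorem forestSize_map_range (g : ℕ → LTree) (m : ℕ) :
    forestSize ((List.range m).map g) = ∑ i ∈ Finset.range m, (g i).size := by
  induction m with
  | zero => simp
  | succ m ih => rw [List.range_succ, List.map_append, forestSize_append, ih,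
      Finset.sum_range_succ]; simp

theorem forestSize_map_range_le {g : ℕ → LTree} {m : ℕ} {K : ℝ} {c : ℕ → ℝ}
    (h : ∀ i, i < m → ((g i).size : ℝ) ≤ K * c i) :
    (forestSize ((List.range m).map g) : ℝ) ≤ K * ∑ i ∈ Finset.range m, c i := by
  rw [forestSize_map_range, Nat.cast_sum, Finset.mul_sum]
  exact Finset.sum_le_sum fun i hi => h i (Finset.mem_range.1 hi)

theorem rpow_le_mul_rpow {k n : ℕ} {x : ℝ} (hx : 0 ≤ x) (h : (k : ℝ) ≤ n * x) :
    (k : ℝ) ^ (2.318 : ℝ) ≤ (n : ℝ) ^ (2.318 : ℝ) * x ^ (2.318 : ℝ) := by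
  rw [← Real.mul_rpow (by positivity) hx]
  exact Real.rpow_le_rpow (by positivity) h (by norm_num)

theorem rpow_div_succ_le (n i : ℕ) :
    (((n - 1) / (i + 1) : ℕ) : ℝ) ^ (2.318 : ℝ) ≤
      (n : ℝ) ^ (2.318 : ℝ) * ((i : ℝ) + 1) ^ (-2.318 : ℝ) := by
  have hi : (0 : ℝ) ≤ (i : ℝ) + 1 := by positivity
  rw [Real.rpow_neg hi, ← Real.inv_rpow hi]
  refine rpow_le_mul_rpow (by positivity) ?_
  calc (((n - 1) / (i + 1) : ℕ) : ℝ) ≤ ((n - 1 : ℕ) : ℝ) / ((i + 1 : ℕ) : ℝ) := Nat.cast_div_le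
    _ ≤ (n : ℝ) / ((i + 1 : ℕ) : ℝ) := by gcongr; omega
    _ = _ := by push_cast; rw [div_eq_mul_inv]

set_option exponentiation.threshold 2000 in
theorem rpow_half_le : (1 / 2 : ℝ) ^ (2.318 : ℝ) ≤ 0.2005454 := by
  rw [show (2.318 : ℝ) = ((1159 : ℤ) : ℝ) / 500 by norm_num]
  exact rpow_div_le (by norm_num) (by norm_num) _ (by norm_num)

set_option exponentiation.threshold 2000 in
theorem rpow_light_le : (17 / 50 : ℝ) ^ (2.318 : ℝ) ≤ 0.0820292 := by
  rw [show (2.318 : ℝ) = ((1159 : ℤ) : ℝ) / 500 by norm_num]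
  exact rpow_div_le (by norm_num) (by norm_num) _ (by norm_num)

set_option exponentiation.threshold 2000 in
theorem rpow_heavy_le : (33 / 50 : ℝ) ^ (2.318 : ℝ) ≤ 0.3816831 := by
  rw [show (2.318 : ℝ) = ((1159 : ℤ) : ℝ) / 500 by norm_num]
  exact rpow_div_le (by norm_num) (by norm_num) _ (by norm_num)

theorem sum_heavy_le (m : ℕ) :
    ∑ i ∈ Finset.range m, (if i = 0 then (33 / 50 : ℝ) ^ (2.318 : ℝ) else
      ((i : ℝ) + 1) ^ (-2.318 : ℝ)) ≤ 0.8048531 := by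
  cases m with
  | zero => norm_num
  | succ m =>
    have h := sum_rpow_le (m + 1)
    rw [Finset.sum_range_succ'] at h ⊢
    simp only [Nat.add_eq_zero_iff, one_ne_zero, and_false, if_false, if_true, CharP.cast_eq_zero,
      zero_add, Real.one_rpow] at h ⊢
    linarith [rpow_heavy_le]

theorem unmarkedForest_map_range {g : ℕ → LTree} {m : ℕ}
    (h : ∀ i, i < m → (g i).Unmarked) : UnmarkedForest ((List.range m).map g) := by
  intro t ht
  obtain ⟨i, hi, rfl⟩ := List.mem_map.1 ht
  exact h i (List.mem_range.1 hi)

theorem exists_universal (n : ℕ) :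
    (1 ≤ n → ∃ U : LTree, U.Unmarked ∧ UniversalTree n U ∧
      (U.size : ℝ) ≤ 100000 * (n : ℝ) ^ (2.318 : ℝ)) ∧
    ∃ D, UnmarkedContext D ∧ UniversalContext n D ∧
      (contextSize D : ℝ) ≤ 237640 * (n : ℝ) ^ (2.318 : ℝ) := by
  induction n using Nat.strong_induction_on with
  | _ n ih =>
  rcases Nat.eq_zero_or_pos n with rfl | hn
  · refine ⟨by simp, [], by simp [UnmarkedContext], fun C _ hC t s hts => ?_, by norm_num⟩
    cases C with
    | nil => exact hts
    | cons F C => simp at hC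
  have hX : (1 : ℝ) ≤ (n : ℝ) ^ (2.318 : ℝ) :=
    Real.one_le_rpow (by exact_mod_cast hn) (by norm_num)
  have htree : ∀ k, ∃ U : LTree, 1 ≤ k → k < n → U.Unmarked ∧ UniversalTree k U ∧
      (U.size : ℝ) ≤ 100000 * (k : ℝ) ^ (2.318 : ℝ) := fun k => by
    by_cases hk : 1 ≤ k ∧ k < n
    · obtain ⟨U, hU⟩ := (ih k hk.2).1 hk.1
      exact ⟨U, fun _ _ => hU⟩
    · exact ⟨.node false [], fun h₁ h₂ => absurd ⟨h₁, h₂⟩ hk⟩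
  choose U hU using htree
  have hdiv : ∀ i, i < n - 1 → 1 ≤ (n - 1) / (i + 1) ∧ (n - 1) / (i + 1) < n := fun i hi =>
    ⟨(Nat.one_le_div_iff (by omega)).2 (by omega),
      (Nat.div_le_self _ _).trans_lt (by omega)⟩
  constructor
  · intro _
    have hb : 33 * n / 50 < n := by omega
    obtain ⟨M, hMu, hM, hMs⟩ := (ih (n - 1 - 33 * n / 50) (by omega)).2
    let k : ℕ → ℕ := fun i => if i = 0 then 33 * n / 50 else (n - 1) / (i + 1)
    have hk : ∀ i, i < n - 1 → 1 ≤ k i ∧ k i < n := fun i hi => by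
      dsimp only [k]
      split_ifs
      · omega
      · exact hdiv i hi
    have hUk : ∀ i, i < n - 1 → _ := fun i hi => hU (k i) (hk i hi).1 (hk i hi).2
    refine ⟨_, hMu.plug (unmarked_node.2 ⟨rfl, unmarkedForest_map_range (g := fun i => U (k i))
      fun i hi => (hUk i hi).1⟩), universalTree_plug hb hM fun i hi => (hUk i hi).2.1, ?_⟩
    have hF := forestSize_map_range_le (g := fun i => U (k i)) (m := n - 1)
      (K := 100000 * (n : ℝ) ^ (2.318 : ℝ))
      (c := fun i => if i = 0 then (33 / 50 : ℝ) ^ (2.318 : ℝ) else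
        ((i : ℝ) + 1) ^ (-2.318 : ℝ)) fun i hi => by
      refine (hUk i hi).2.2.trans ?_
      rw [mul_assoc]
      gcongr
      dsimp only [k]
      split_ifs
      · refine rpow_le_mul_rpow (by norm_num) (le_trans Nat.cast_div_le (le_of_eq ?_))
        push_cast
        ring
      · exact rpow_div_succ_le n i
    have hM' : ((n - 1 - 33 * n / 50 : ℕ) : ℝ) ^ (2.318 : ℝ) ≤
        (n : ℝ) ^ (2.318 : ℝ) * 0.0820292 := by
      refine (rpow_le_mul_rpow (n := n) (x := 17 / 50) (by norm_num) ?_).trans ?_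
      · have : 50 * (n - 1 - 33 * n / 50) ≤ 17 * n := by omega
        have : (50 : ℝ) * ((n - 1 - 33 * n / 50 : ℕ) : ℝ) ≤ 17 * n := by exact_mod_cast this
        linarith
      · gcongr
        exact rpow_light_le
    have hF' := hF.trans (mul_le_mul_of_nonneg_left (sum_heavy_le (n - 1)) (by positivity))
    rw [size_plug, size_node_eq]
    push_cast
    linarith
  · obtain ⟨M, hMu, hM, hMs⟩ := (ih (n / 2) (by omega)).2
    have hUk : ∀ i, i < n - 1 → _ := fun i hi => hU _ (hdiv i hi).1 (hdiv i hi).2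
    refine ⟨_, ?_, universalContext_append hM fun i hi => (hUk i hi).2.1, ?_⟩
    · intro F hF
      simp only [List.mem_append, List.mem_cons] at hF
      rcases hF with hF | rfl | hF
      · exact hMu F hF
      · exact unmarkedForest_map_range fun i hi => (hUk i hi).1
      · exact hMu F hF
    have hF := forestSize_map_range_le (g := fun i => U ((n - 1) / (i + 1))) (m := n - 1)
      (K := 100000 * (n : ℝ) ^ (2.318 : ℝ))
      (c := fun i => ((i : ℝ) + 1) ^ (-2.318 : ℝ)) fun i hi => by
      refine (hUk i hi).2.2.trans ?_
      rw [mul_assoc]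
      gcongr
      exact rpow_div_succ_le n i
    have hM' : ((n / 2 : ℕ) : ℝ) ^ (2.318 : ℝ) ≤ (n : ℝ) ^ (2.318 : ℝ) * 0.2005454 := by
      refine (rpow_le_mul_rpow (n := n) (x := 1 / 2) (by norm_num) ?_).trans ?_
      · refine Nat.cast_div_le.trans (le_of_eq ?_)
        push_cast
        ring
      · gcongr
        exact rpow_half_le
    have hF' := hF.trans (mul_le_mul_of_nonneg_left (sum_rpow_le (n - 1)) (by positivity))
    rw [contextSize_append, contextSize_cons]
    push_cast
    linarith

/-- A tree whose only marked vertex is a leaf is a context with a marked leaf hung below it. -/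
theorem exists_context_of_unique_marked_leaf (p : List ℕ) :
    ∀ t : LTree, t.label p = some true → (∀ q, t.label q = some true → q = p) →
      (∀ i, t.label (p ++ [i]) = none) →
      ∃ C, UnmarkedContext C ∧ contextSize C + 1 = t.size ∧
        Emb t (plug C (.node true [])) := by
  induction p with
  | nil =>
    rintro ⟨b, l⟩ hp - hleaf
    obtain rfl : b = true := by simpa using hp
    obtain rfl : l = [] := by
      cases l with
      | nil => rfl
      | cons t l =>
        rcases t with ⟨c, m⟩
        simpa using hleaf 0
    exact ⟨[], by simp [UnmarkedContext], by simp, Emb.refl _⟩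
  | cons i p ih =>
    rintro ⟨b, l⟩ hp huniq hleaf
    obtain rfl : b = false := by
      by_contra h
      simpa using huniq [] (by simpa using h)
    obtain ⟨x, hx, hp⟩ := Option.bind_eq_some_iff.1 ((label_cons ..).symm.trans hp)
    obtain ⟨C, hC, hsize, hemb⟩ := ih x hp
      (fun q hq => (List.cons.inj (huniq (i :: q) (by simp [hx, hq]))).2)
      (fun j => by simpa [hx] using hleaf j)
    obtain ⟨hi, rfl⟩ := List.getElem?_eq_some_iff.1 hx
    have hperm : l.Perm (l[i] :: l.eraseIdx i) := (List.getElem_cons_eraseIdx_perm hi).symm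
    refine ⟨l.eraseIdx i :: C, List.forall_mem_cons.2 ⟨fun y hy q hq => ?_, hC⟩, ?_, ?_⟩
    · obtain ⟨j, hji, hj⟩ := List.mem_eraseIdx_iff_getElem?.1 hy
      exact hji (List.cons.inj (huniq (j :: q) (by simp [hj, hq]))).1
    · have h := (hperm.map size).sum_eq
      simp only [List.map_cons, List.sum_cons] at h
      simp only [contextSize_cons, size_node_eq, forestSize]
      omega
    · exact Emb.node _ ((ForestEmb.of_perm hperm).trans (ForestEmb.cons hemb (ForestEmb.refl _)))

theorem label_plug_marked {C : List (List LTree)} (hC : UnmarkedContext C) {q : List ℕ} :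
    (plug C (.node true [])).label q = some true ↔ q = List.replicate C.length 0 := by
  induction C generalizing q with
  | nil =>
    cases q with
    | nil => simp [plug]
    | cons i q => simp [plug]
  | cons F C ih =>
    have hF := hC F List.mem_cons_self
    rcases q with _ | ⟨_ | i, q⟩
    · simp [plug, List.replicate_succ]
    · simpa [plug, List.replicate_succ] using ih fun G hG => hC G (List.mem_cons_of_mem _ hG)
    · simp only [plug, label_cons, List.getElem?_cons_succ, List.length_cons, List.replicate_succ,
        List.cons.injEq, Nat.add_eq_zero_iff, one_ne_zero, and_false, false_and, iff_false]
      intro h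
      obtain ⟨t, ht, h⟩ := Option.bind_eq_some_iff.1 h
      exact hF t (List.mem_of_getElem? ht) q h

theorem label_plug_leaf (C : List (List LTree)) (b : Bool) (i : ℕ) :
    (plug C (.node b [])).label (List.replicate C.length 0 ++ [i]) = none := by
  induction C with
  | nil => simp [plug]
  | cons F C ih => simpa [plug, List.replicate_succ] using ih

/-- The vertices of a tree. -/
abbrev Vertex (t : LTree) : Type := {p : List ℕ // t.label p ≠ none}

def vertexNodeEquiv (b : Bool) (l : List LTree) :
    Vertex (.node b l) ≃ Option (Σ i : Fin l.length, Vertex l[i]) where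
  toFun
    | ⟨[], _⟩ => none
    | ⟨i :: p, h⟩ =>
      have hi : i < l.length := by
        by_contra hi
        exact h (by simp [List.getElem?_eq_none (not_lt.1 hi)])
      some ⟨⟨i, hi⟩, p, by simpa [List.getElem?_eq_getElem hi] using h⟩
  invFun
    | none => ⟨[], by simp⟩
    | some ⟨i, p, h⟩ => ⟨i :: p, by simpa using h⟩
  left_inv := by rintro ⟨_ | ⟨i, p⟩, h⟩ <;> rfl
  right_inv := by rintro (_ | ⟨i, p, h⟩) <;> rfl

theorem finite_vertex_and_card : ∀ t : LTree, Finite t.Vertex ∧ Nat.card t.Vertex = t.size := by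
  apply children_induction
  intro b l ih
  have hfin : ∀ i : Fin l.length, Finite (Vertex l[i]) := fun i => (ih _ (by simp)).1
  have e := vertexNodeEquiv b l
  refine ⟨Finite.of_equiv _ e.symm, ?_⟩
  rw [Nat.card_congr e, Finite.card_option, Nat.card_sigma, size_node, add_comm]
  congr 1
  rw [Finset.sum_congr rfl fun i _ => (ih l[i] (by simp)).2, Fin.sum_univ_def]
  congr 1
  refine List.ext_getElem (by simp) fun i h₁ h₂ => by simp

theorem dropLast_iterate_prefix (k : ℕ) (p : List ℕ) : List.dropLast^[k] p <+: p := by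
  induction k with
  | zero => simp
  | succ k ih =>
    rw [Function.iterate_succ_apply']
    exact (List.dropLast_prefix _).trans ih

theorem dropLast_iterate_append (p q : List ℕ) : List.dropLast^[q.length] (p ++ q) = p := by
  induction q using List.reverseRecOn with
  | nil => simp
  | append_singleton q a ih =>
    rw [List.length_append, List.length_singleton, Function.iterate_succ_apply,
      ← List.append_assoc, List.dropLast_concat, ih]

theorem exists_finRootedTree (s : LTree) :
    ∃ (R : FinRootedTree) (e : s.Vertex ≃ Fin R.n), R.n = s.size ∧
      ∀ p q, R.IsAncestor (e p) (e q) ↔ p.1 <+: q.1 := by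
  obtain ⟨hfin, hcard⟩ := s.finite_vertex_and_card
  let e : s.Vertex ≃ Fin s.size := Finite.equivFinOfCardEq hcard
  let par : s.Vertex → s.Vertex := fun p => ⟨p.1.dropLast, by
    obtain ⟨q, hq⟩ := List.dropLast_prefix p.1
    exact label_ne_none_of_append (q := q) (by rw [hq]; exact p.2)⟩
  let rt : s.Vertex := ⟨[], by rcases s with ⟨b, l⟩; simp⟩
  let parent : Fin s.size → Fin s.size := fun i => e (par (e.symm i))
  have hpar : ∀ k p, (par^[k] p).1 = List.dropLast^[k] p.1 := fun k p => by
    induction k with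
    | zero => rfl
    | succ k ih => rw [Function.iterate_succ_apply', Function.iterate_succ_apply', ← ih]
  have hparent : ∀ k p, parent^[k] (e p) = e (par^[k] p) := fun k p => by
    induction k with
    | zero => rfl
    | succ k ih => simp [Function.iterate_succ_apply', ih, parent]
  have hanc : ∀ p q, IsAncestorOf parent (e p) (e q) ↔ p.1 <+: q.1 := fun p q => by
    constructor
    · rintro ⟨k, hk⟩
      rw [hparent, e.apply_eq_iff_eq] at hk
      rw [← hk, hpar]
      exact dropLast_iterate_prefix k q.1
    · rintro ⟨r, hr⟩
      refine ⟨r.length, ?_⟩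
      rw [hparent, e.apply_eq_iff_eq, Subtype.ext_iff, hpar, ← hr, dropLast_iterate_append]
  refine ⟨⟨s.size, s.size_pos, parent, e rt, hparent 1 rt, fun v => ?_⟩, e, rfl, hanc⟩
  obtain ⟨p, rfl⟩ := e.surjective v
  exact (hanc rt p).2 List.nil_prefix

end LTree

section OfParent

variable {V : Type*} [Fintype V] [DecidableEq V] (parent : V → V)

/-- The children of a vertex, in some order. -/
noncomputable def childList (v : V) : List V :=
  (Finset.univ.filter fun u => parent u = v ∧ u ≠ v).toList

theorem mem_childList {u v : V} : u ∈ childList parent v ↔ parent u = v ∧ u ≠ v := by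
  simp [childList]

/-- Walk down from a vertex along the given child indices. -/
noncomputable def walk : V → List ℕ → Option V
  | v, [] => some v
  | v, i :: p => (childList parent v)[i]?.bind fun u => walk u p

theorem walk_append (v : V) (p q : List ℕ) :
    walk parent v (p ++ q) = (walk parent v p).bind fun u => walk parent u q := by
  induction p generalizing v with
  | nil => rw [walk]; rfl
  | cons i p ih =>
    rw [List.cons_append, walk, walk, Option.bind_assoc]
    simp_rw [ih]

theorem walk_concat_eq_some {v u : V} {p : List ℕ} {i : ℕ} :
    walk parent v (p ++ [i]) = some u ↔
      ∃ x, walk parent v p = some x ∧ (childList parent x)[i]? = some u := by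
  rw [walk_append, Option.bind_eq_some_iff]
  simp [walk]

theorem isAncestorOf_of_walk {v u : V} {p : List ℕ} (h : walk parent v p = some u) :
    IsAncestorOf parent v u := by
  induction p using List.reverseRecOn generalizing u with
  | nil =>
    rw [walk, Option.some_inj] at h
    exact ⟨0, h.symm⟩
  | append_singleton p i ih =>
    obtain ⟨x, hx, hu⟩ := (walk_concat_eq_some parent).1 h
    obtain ⟨k, hk⟩ := ih hx
    refine ⟨k + 1, ?_⟩
    rwa [Function.iterate_succ_apply, ((mem_childList parent).1 (List.mem_of_getElem? hu)).1]

/-- The tree of all vertices that are reached from `v` in at most `k` steps downwards, with the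
vertex `w` marked. -/
noncomputable def unfolding (w : V) : ℕ → V → LTree
  | 0, v => .node (v = w) []
  | k + 1, v => .node (v = w) ((childList parent v).map (unfolding w k))

theorem label_unfolding_of_length_le (w : V) {k : ℕ} {v : V} {p : List ℕ} (hp : p.length ≤ k) :
    (unfolding parent w k v).label p = (walk parent v p).map fun u => decide (u = w) := by
  induction k generalizing v p with
  | zero =>
    obtain rfl : p = [] := by simpa using hp
    simp [unfolding, walk]
  | succ k ih =>
    cases p with
    | nil => simp [unfolding, walk]
    | cons i p =>
      rw [unfolding, LTree.label_cons, walk, List.getElem?_map]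
      cases (childList parent v)[i]? with
      | none => rfl
      | some u => exact ih (by simpa using hp)

theorem length_le_of_label_unfolding (w : V) {k : ℕ} {v : V} {p : List ℕ}
    (h : (unfolding parent w k v).label p ≠ none) : p.length ≤ k := by
  induction k generalizing v p with
  | zero =>
    cases p with
    | nil => simp
    | cons i p => simp [unfolding] at h
  | succ k ih =>
    cases p with
    | nil => simp
    | cons i p =>
      rw [unfolding, LTree.label_cons, List.getElem?_map] at h
      cases hi : (childList parent v)[i]? with
      | none => simp [hi] at h
      | some u =>
        have := ih (v := u) (p := p) (by simpa [hi] using h)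
        simpa using this

variable {parent} {root : V}

theorem walk_root_inj (hroot : parent root = root) {u : V} {p q : List ℕ}
    (hp : walk parent root p = some u) (hq : walk parent root q = some u) : p = q := by
  have key : ∀ {p : List ℕ} {i : ℕ}, walk parent root (p ++ [i]) ≠ some root := by
    intro p i h
    obtain ⟨x, -, hi⟩ := (walk_concat_eq_some parent).1 h
    have := (mem_childList parent).1 (List.mem_of_getElem? hi)
    exact this.2 (hroot.symm.trans this.1)
  induction p using List.reverseRecOn generalizing u q with
  | nil =>
    obtain rfl : root = u := by simpa [walk] using hp
    rcases List.eq_nil_or_concat q with rfl | ⟨q, j, rfl⟩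
    · rfl
    · exact absurd (by simpa using hq) key
  | append_singleton p i ih =>
    rcases List.eq_nil_or_concat q with rfl | ⟨q, j, rfl⟩
    · obtain rfl : root = u := by simpa [walk] using hq
      exact absurd hp key
    · rw [List.concat_eq_append] at hq ⊢
      obtain ⟨x, hx, hi⟩ := (walk_concat_eq_some parent).1 hp
      obtain ⟨y, hy, hj⟩ := (walk_concat_eq_some parent).1 hq
      obtain rfl : x = y := ((mem_childList parent).1 (List.mem_of_getElem? hi)).1.symm.trans
        ((mem_childList parent).1 (List.mem_of_getElem? hj)).1
      obtain rfl := ih hx hy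
      rw [(List.getElem?_inj (List.getElem?_eq_some_iff.1 hi).1
        (Finset.nodup_toList _)).1 (hi.trans hj.symm)]

theorem exists_walk_parent_concat {u : V} {p : List ℕ} (hu : u ≠ parent u)
    (hp : walk parent root p = some (parent u)) : ∃ i, walk parent root (p ++ [i]) = some u := by
  obtain ⟨i, hi⟩ := List.mem_iff_getElem?.1 ((mem_childList parent).2 ⟨rfl, hu⟩)
  exact ⟨i, (walk_concat_eq_some parent).2 ⟨_, hp, hi⟩⟩

theorem exists_walk_root (hreach : ∀ v, ∃ k : ℕ, parent^[k] v = root) (u : V) :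
    ∃ p, walk parent root p = some u := by
  obtain ⟨k, hk⟩ := hreach u
  induction k generalizing u with
  | zero => exact ⟨[], by rw [walk]; exact congrArg some hk.symm⟩
  | succ k ih =>
    obtain ⟨p, hp⟩ := ih (parent u) hk
    by_cases hu : u = parent u
    · exact ⟨p, by rwa [hu]⟩
    · obtain ⟨i, hi⟩ := exists_walk_parent_concat hu hp
      exact ⟨_, hi⟩

/-- Addresses in a labelled tree for the vertices of a rooted tree given by a parent function. -/
theorem exists_addresses (hroot : parent root = root)
    (hreach : ∀ v, ∃ k : ℕ, parent^[k] v = root) (w : V) :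
    ∃ (t : LTree) (a : V → List ℕ), t.size ≤ Fintype.card V ∧ Function.Injective a ∧
      (∀ v, t.label (a v) = some (decide (v = w))) ∧ (∀ p, t.label p ≠ none → ∃ v, a v = p) ∧
      (∀ u v, a u <+: a v ↔ IsAncestorOf parent u v) := by
  choose a ha using exists_walk_root hreach
  have hN : ∀ v, (a v).length ≤ ∑ u, (a u).length := fun v =>
    Finset.single_le_sum (f := fun u => (a u).length) (fun _ _ => Nat.zero_le _)
      (Finset.mem_univ v)
  have hlabel : ∀ v, (unfolding parent w (∑ u, (a u).length) root).label (a v) =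
      some (decide (v = w)) := fun v => by
    rw [label_unfolding_of_length_le parent w (hN v), ha]
    rfl
  have hsurj : ∀ p, (unfolding parent w (∑ u, (a u).length) root).label p ≠ none →
      ∃ v, a v = p := fun p hp => by
    rw [label_unfolding_of_length_le parent w (length_le_of_label_unfolding parent w hp)] at hp
    obtain ⟨v, hv⟩ := Option.ne_none_iff_exists'.1
      fun h : walk parent root p = none => hp (by rw [h]; rfl)
    exact ⟨v, walk_root_inj hroot (ha v) hv⟩
  refine ⟨_, a, ?_, fun u v huv => ?_, hlabel, hsurj, fun u v => ⟨?_, ?_⟩⟩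
  · rw [← (LTree.finite_vertex_and_card _).2, ← Nat.card_eq_fintype_card]
    refine Nat.card_le_card_of_surjective (fun v => ⟨a v, by simp [hlabel]⟩) ?_
    rintro ⟨p, hp⟩
    obtain ⟨v, rfl⟩ := hsurj p hp
    exact ⟨v, rfl⟩
  · have := ha u
    rw [huv, ha v] at this
    exact (Option.some_inj.1 this).symm
  · rintro ⟨q, hq⟩
    have := ha v
    rw [← hq, walk_append, ha u] at this
    exact isAncestorOf_of_walk parent this
  · rintro ⟨k, rfl⟩
    induction k generalizing v with
    | zero => exact List.prefix_rfl
    | succ k ih =>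
      rw [Function.iterate_succ_apply]
      refine (ih (parent v)).trans ?_
      by_cases hv : v = parent v
      · rw [← hv]
      · obtain ⟨i, hi⟩ := exists_walk_parent_concat hv (ha (parent v))
        rw [← walk_root_inj hroot hi (ha v)]
        exact List.prefix_append _ _

end OfParent

theorem lcp_address {V : Type*} {parent : V → V} {t : LTree} {a : V → List ℕ}
    (ha : ∀ v, t.label (a v) ≠ none) (hsurj : ∀ p, t.label p ≠ none → ∃ v, a v = p)
    (hanc : ∀ u v, a u <+: a v ↔ IsAncestorOf parent u v) {u v w : V}
    (h : IsNcaOf parent u v w) : lcp (a u) (a v) = a w := by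
  obtain ⟨hu, hv, hmax⟩ := h
  have hl := lcp_prefix_left (a u) (a v)
  obtain ⟨x, hx⟩ := hsurj (lcp (a u) (a v)) (by
    obtain ⟨q, hq⟩ := hl
    exact LTree.label_ne_none_of_append (q := q) (by rw [hq]; exact ha u))
  have hw : a w <+: a x := by
    rw [hx]
    exact prefix_lcp ((hanc _ _).2 hu) ((hanc _ _).2 hv)
  have hxw : a x <+: a w := by
    refine (hanc _ _).2 (hmax x ((hanc _ _).1 ?_) ((hanc _ _).1 ?_))
    · rwa [hx]
    · rw [hx]
      exact lcp_prefix_right _ _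
  rw [← hx]
  exact hxw.eq_of_length_le hw.length_le

end NcaUniversal


/-- There is an absolute constant `c` such that for every `n ≥ 1` there is a rooted tree `S'`
with at most `c · n ^ 2.318` vertices and one marked leaf `w` that is NCA-universal for the
family of all rooted trees on at most `n` vertices with one marked leaf: the embedding maps
the marked leaf of `T` to `w`. -/
theorem nca_universal_tree_general_marked :
    ∃ c : ℝ, ∀ n : ℕ, 1 ≤ n →
      ∃ (S' : FinRootedTree) (w : Fin S'.n), S'.IsLeaf w ∧
        (S'.n : ℝ) ≤ c * (n : ℝ) ^ (2.318 : ℝ) ∧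
        ∀ (T : FinRootedTree) (wT : Fin T.n), T.IsLeaf wT → T.n ≤ n →
          ∃ φ : Fin T.n → Fin S'.n, NcaEmbedding T S' φ ∧ φ wT = w := by
  classical
  refine ⟨337640, fun n hn => ?_⟩
  obtain ⟨-, D, hD, huniv, hsize⟩ := NcaUniversal.LTree.exists_universal n
  obtain ⟨R, e, hR, hanc⟩ :=
    NcaUniversal.LTree.exists_finRootedTree (NcaUniversal.LTree.plug D (.node true []))
  have hw := (NcaUniversal.LTree.label_plug_marked hD).2 rfl
  refine ⟨R, e ⟨_, by rw [hw]; simp⟩, fun u hu => ?_, ?_, fun T wT hwT hT => ?_⟩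
  · obtain ⟨⟨q, hq⟩, rfl⟩ := e.surjective u
    obtain ⟨r, rfl⟩ : List.replicate D.length 0 <+: q := (hanc _ _).1 ⟨1, hu⟩
    rw [e.apply_eq_iff_eq, Subtype.mk.injEq]
    rcases r with _ | ⟨i, r⟩
    · simp
    · refine absurd (NcaUniversal.LTree.label_plug_leaf D true i)
        (NcaUniversal.LTree.label_ne_none_of_append (q := r) ?_)
      rwa [List.append_assoc, List.singleton_append]
  · have hX : (1 : ℝ) ≤ (n : ℝ) ^ (2.318 : ℝ) :=
      Real.one_le_rpow (by exact_mod_cast hn) (by norm_num)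
    rw [hR, NcaUniversal.LTree.size_plug]
    simp only [NcaUniversal.LTree.size_node_eq, NcaUniversal.LTree.forestSize_nil]
    push_cast
    linarith
  · obtain ⟨t, a, hcard, hinj, hlabel, hsurj, hpre⟩ :=
      NcaUniversal.exists_addresses T.parent_root T.reaches_root wT
    rw [Fintype.card_fin] at hcard
    have hne : ∀ v, t.label (a v) ≠ none := fun v => by rw [hlabel]; simp
    obtain ⟨C, hC, hCs, hemb⟩ := NcaUniversal.LTree.exists_context_of_unique_marked_leaf (a wT) t
      (by simp [hlabel])
      (fun q hq => by
        obtain ⟨v, rfl⟩ := hsurj q (by rw [hq]; simp)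
        rw [hlabel] at hq
        rw [show v = wT by simpa using hq])
      (fun i => by
        by_contra hi
        obtain ⟨v, hv⟩ := hsurj _ hi
        obtain ⟨k, hk⟩ := (hpre wT v).1 (hv ▸ List.prefix_append _ _)
        have hvw : v = wT := by
          clear hv
          induction k generalizing v with
          | zero => exact hk
          | succ k ih => exact hwT v (ih _ hk)
        rw [hvw] at hv
        simpa using congrArg List.length hv)
    obtain ⟨f, hf⟩ := hemb.trans (huniv C hC (by omega) _ _ (NcaUniversal.LTree.Emb.refl _))
    refine ⟨fun v => e ⟨f (a v), by rw [hf.label_eq _ (hne v)]; exact hne v⟩,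
      ⟨fun u v huv => ?_, fun u v w h => ?_⟩, ?_⟩
    · rw [e.apply_eq_iff_eq, Subtype.mk.injEq] at huv
      exact hinj (hf.inj _ _ (hne u) (hne v) huv)
    · have hlcp := hf.map_lcp _ _ (hne u) (hne v)
      rw [NcaUniversal.lcp_address hne hsurj hpre h] at hlcp
      refine ⟨(hanc _ _).2 ?_, (hanc _ _).2 ?_, fun x hxu hxv => ?_⟩
      · simpa only [hlcp] using NcaUniversal.lcp_prefix_left (f (a u)) (f (a v))
      · simpa only [hlcp] using NcaUniversal.lcp_prefix_right (f (a u)) (f (a v))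
      · obtain ⟨x, rfl⟩ := e.surjective x
        refine (hanc _ _).2 ?_
        simpa only [hlcp] using NcaUniversal.prefix_lcp ((hanc _ _).1 hxu) ((hanc _ _).1 hxv)
    · rw [e.apply_eq_iff_eq, Subtype.mk.injEq]
      refine (NcaUniversal.LTree.label_plug_marked hD).1 ?_
      rw [hf.label_eq _ (hne wT), hlabel]
      simp
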